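/- Let X and Y be CAT(0) cube complexes with no extremal vertices, each having at least two vertices and neither isomorphic to the standard cubulation of ℝ. If F, G : X → Y are cubical isomorphisms whose induced homeomorphisms F̄, Ḡ : X̄ → Ȳ of Roller compactifications agree on the Roller boundary ∂X, then F = G. -/

import Mathlib

/-!
We use the standard combinatorial model of a CAT(0) cube complex: it is identified
with its vertex set endowed with the combinatorial (ℓ¹) metric, i.e. with a median
graph `G` on a vertex type `V`.  Halfspaces are realised as the vertex sets of the
two sides of the hyperplane dual to an edge, the Roller compactification `X̄` is the
set of ultrafilters of halfspaces, vertices embedding via principal ultrafilters,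
and the Roller boundary `∂X` consists of the non-principal ultrafilters.
-/

open scoped ENNReal
open Set

namespace CCCR

variable {V V' : Type*}

/-- The interval between two vertices w.r.t. the combinatorial metric. -/
def vInterval (G : SimpleGraph V) (u v : V) : Set V :=
  {w : V | G.dist u w + G.dist w v = G.dist u v}

/-- Combinatorial model of a CAT(0) cube complex (identified with its vertex set,
endowed with the combinatorial metric): a connected median graph. -/
def IsCCC (G : SimpleGraph V) : Prop :=
  G.Connected ∧ ∀ x y z : V, ∃! m : V,
    m ∈ vInterval G x y ∧ m ∈ vInterval G y z ∧ m ∈ vInterval G z x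

/-- Halfspaces of the cube complex: the sides of the hyperplane dual to an edge. -/
def IsHalfspace (G : SimpleGraph V) (h : Set V) : Prop :=
  ∃ u v : V, G.Adj u v ∧ h = {w : V | G.dist w v < G.dist w u}

/-- The halfspace dual to the (oriented) edge `(u,v)` containing `v`. -/
def edgeHalf (G : SimpleGraph V) (u v : V) : Set V :=
  {w : V | G.dist w v < G.dist w u}

/-- The hyperplane (wall) dual to the edge `(u,v)`, recorded as its pair of sides. -/
def wallOf (G : SimpleGraph V) (u v : V) : Set (Set V) :=
  {edgeHalf G u v, (edgeHalf G u v)ᶜ}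

/-- Two (necessarily distinct) hyperplanes, with respective sides `h` and `k`,
are transverse: all four quarter-spaces are nonempty. -/
def Transv (h k : Set V) : Prop :=
  (h ∩ k).Nonempty ∧ (h ∩ kᶜ).Nonempty ∧ (hᶜ ∩ k).Nonempty ∧ (hᶜ ∩ kᶜ).Nonempty

/-- An ultrafilter of halfspaces: a point of the Roller compactification X̄.
It contains exactly one side of each hyperplane, and any two members intersect. -/
def IsUltra (G : SimpleGraph V) (σ : Set (Set V)) : Prop :=
  (∀ h ∈ σ, IsHalfspace G h) ∧
  (∀ h : Set V, IsHalfspace G h → (h ∈ σ ↔ hᶜ ∉ σ)) ∧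
  (∀ h ∈ σ, ∀ k ∈ σ, (h ∩ k).Nonempty)

/-- The principal ultrafilter of a vertex, i.e. the image of `v` in X̄. -/
def princ (G : SimpleGraph V) (v : V) : Set (Set V) :=
  {h : Set V | IsHalfspace G h ∧ v ∈ h}

/-- A point of the Roller boundary ∂X = X̄ ∖ X: a non-principal ultrafilter. -/
def IsBdryPt (G : SimpleGraph V) (σ : Set (Set V)) : Prop :=
  IsUltra G σ ∧ ∀ v : V, σ ≠ princ G v

/-- The Roller boundary ∂X as a type. -/
abbrev Bdry (G : SimpleGraph V) : Type _ := {σ : Set (Set V) // IsBdryPt G σ}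

/-- The Gromov product (x·y)_v = #𝒲(v | x, y) ∈ ℕ ∪ {+∞}, counted through the
sides containing both x and y but not v. -/
noncomputable def grom (_G : SimpleGraph V) (v : V) (x y : Set (Set V)) : ℕ∞ :=
  {h : Set V | h ∈ x ∧ h ∈ y ∧ v ∉ h}.encard

/-- The embedding ℕ ∪ {+∞} → ℤ ∪ {±∞}. -/
noncomputable def toE (n : ℕ∞) : EReal := ((n : ℝ≥0∞) : EReal)

/-- The cross ratio cr_v(x,y,z,w) = (x·z)_v + (y·w)_v − (x·w)_v − (y·z)_v ∈ ℤ ∪ {±∞}. -/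
noncomputable def crv (G : SimpleGraph V) (v : V) (x y z w : Set (Set V)) : EReal :=
  toE (grom G v x z) + toE (grom G v y w) - toE (grom G v x w) - toE (grom G v y z)

/-- The triple of sums of Gromov products attached to a 4-tuple. -/
noncomputable def tripod (G : SimpleGraph V) (v : V) (x y z w : Set (Set V)) :
    ℕ∞ × ℕ∞ × ℕ∞ :=
  (grom G v x y + grom G v z w, grom G v x z + grom G v y w, grom G v x w + grom G v y z)

/-- (x,y,z,w) ∈ 𝒜 w.r.t. the basepoint v: at most one of the three sums is infinite. -/
def inA (G : SimpleGraph V) (v : V) (x y z w : Set (Set V)) : Prop :=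
  ((tripod G v x y z w).1 ≠ ⊤ ∧ (tripod G v x y z w).2.1 ≠ ⊤) ∨
  ((tripod G v x y z w).1 ≠ ⊤ ∧ (tripod G v x y z w).2.2 ≠ ⊤) ∨
  ((tripod G v x y z w).2.1 ≠ ⊤ ∧ (tripod G v x y z w).2.2 ≠ ⊤)

/-- (x,y,z,w) ∈ 𝒜 (this is independent of the basepoint). -/
def memA (G : SimpleGraph V) (x y z w : Set (Set V)) : Prop :=
  ∀ v : V, inA G v x y z w

/-- Two triples in (ℕ ∪ {+∞})³ are equivalent if they differ by adding a constant
n ∈ ℕ to all three entries. -/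
def TripEquiv (p q : ℕ∞ × ℕ∞ × ℕ∞) : Prop :=
  (∃ n : ℕ, p.1 = q.1 + (n : ℕ∞) ∧ p.2.1 = q.2.1 + (n : ℕ∞) ∧ p.2.2 = q.2.2 + (n : ℕ∞)) ∨
  (∃ n : ℕ, q.1 = p.1 + (n : ℕ∞) ∧ q.2.1 = p.2.1 + (n : ℕ∞) ∧ q.2.2 = p.2.2 + (n : ℕ∞))

/-- crt(x,y,z,w) = ⟪a:b:c⟫ (the cross ratio triple is independent of the basepoint,
so we require the equality of classes at every basepoint). -/
def crtEq (G : SimpleGraph V) (x y z w : Set (Set V)) (a b c : ℕ∞) : Prop :=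
  ∀ v : V, TripEquiv (tripod G v x y z w) (a, b, c)

/-- The median of three points of X̄. -/
def med (x y z : Set (Set V)) : Set (Set V) := (x ∩ y) ∪ (y ∩ z) ∪ (z ∩ x)

/-- The interval I(x,y) ⊆ X̄ between two points of X̄. -/
def rInterval (G : SimpleGraph V) (x y : Set (Set V)) : Set (Set (Set V)) :=
  {σ : Set (Set V) | IsUltra G σ ∧ x ∩ y ⊆ σ}

/-- `Op G x y z` : x and y are opposite with respect to z, i.e. the median
m = m(x,y,z) lies in X and I(x,y) = I(x,m) ∪ I(m,y). -/
def Op (G : SimpleGraph V) (x y z : Set (Set V)) : Prop :=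
  (∃ p : V, med x y z = princ G p) ∧
  rInterval G x y = rInterval G x (med x y z) ∪ rInterval G (med x y z) y

/-- A geodesic ray (based at `r 0`). -/
def IsGeodRay (G : SimpleGraph V) (r : ℕ → V) : Prop :=
  (∀ n : ℕ, G.Adj (r n) (r (n + 1))) ∧
  ∀ m n : ℕ, m ≤ n → G.dist (r m) (r n) = n - m

/-- A bi-infinite geodesic line. -/
def IsGeodLine (G : SimpleGraph V) (L : ℤ → V) : Prop :=
  (∀ n : ℤ, G.Adj (L n) (L (n + 1))) ∧
  ∀ m n : ℤ, m ≤ n → (G.dist (L m) (L n) : ℤ) = n - m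

/-- The set 𝒲(r) of hyperplanes crossed by (the edges of) a ray. -/
def rayWalls (G : SimpleGraph V) (r : ℕ → V) : Set (Set (Set V)) :=
  {W : Set (Set V) | ∃ n : ℕ, W = wallOf G (r n) (r (n + 1))}

/-- A hyperplane is adjacent to `v` if it is dual to an edge incident to `v`. -/
def WallAdjTo (G : SimpleGraph V) (v : V) (W : Set (Set V)) : Prop :=
  ∃ u : V, G.Adj v u ∧ W = wallOf G v u

/-- A straight ray: no two of the hyperplanes it crosses are transverse. -/
def RayStraight (G : SimpleGraph V) (r : ℕ → V) : Prop :=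
  ∀ m n : ℕ, ¬ Transv (edgeHalf G (r m) (r (m + 1))) (edgeHalf G (r n) (r (n + 1)))

/-- A straight line: no two of the hyperplanes it crosses are transverse. -/
def LineStraight (G : SimpleGraph V) (L : ℤ → V) : Prop :=
  ∀ m n : ℤ, ¬ Transv (edgeHalf G (L m) (L (m + 1))) (edgeHalf G (L n) (L (n + 1)))

/-- The endpoint at infinity r⁺ ∈ ∂X of a ray: the ultrafilter of those halfspaces
containing all but finitely many of its vertices. -/
def rayEnd (G : SimpleGraph V) (r : ℕ → V) : Set (Set V) :=
  {h : Set V | IsHalfspace G h ∧ ∃ N : ℕ, ∀ n : ℕ, N ≤ n → r n ∈ h}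

/-- A straight point of the Roller boundary: the endpoint at infinity of a straight ray. -/
def IsStraightPt (G : SimpleGraph V) (x : Set (Set V)) : Prop :=
  ∃ r : ℕ → V, IsGeodRay G r ∧ RayStraight G r ∧ rayEnd G r = x

/-- x and y are the two endpoints at infinity of the line L. -/
def LineEnds (G : SimpleGraph V) (L : ℤ → V) (x y : Set (Set V)) : Prop :=
  rayEnd G (fun n : ℕ => L (n : ℤ)) = x ∧ rayEnd G (fun n : ℕ => L (-(n : ℤ))) = y

/-- The edges from `v` to `a` and from `v` to `b` span a square. -/
def SpansSquare (G : SimpleGraph V) (v a b : V) : Prop :=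
  ∃ w : V, w ≠ v ∧ G.Adj a w ∧ G.Adj b w

/-- An extremal vertex: some edge at `v` spans a square with every other edge at `v`. -/
def Extremal (G : SimpleGraph V) (v : V) : Prop :=
  ∃ a : V, G.Adj v a ∧ ∀ b : V, G.Adj v b → b ≠ a → SpansSquare G v a b

/-- The cube complex has no extremal vertices. -/
def NoExtremal (G : SimpleGraph V) : Prop := ∀ v : V, ¬ Extremal G v

/-- A skinny vertex: exactly two incident edges. -/
def Skinny (G : SimpleGraph V) (v : V) : Prop := {u : V | G.Adj v u}.encard = 2

/-- A skinny ray: a geodesic ray whose initial vertex has at least three incident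
edges and all of whose other vertices are skinny. -/
def IsSkinnyRay (G : SimpleGraph V) (r : ℕ → V) : Prop :=
  IsGeodRay G r ∧ 3 ≤ {u : V | G.Adj (r 0) u}.encard ∧ ∀ n : ℕ, 1 ≤ n → Skinny G (r n)

/-- (The vertex set of) a cube of the complex: a subset inducing a hypercube graph. -/
def IsCube (G : SimpleGraph V) (c : Set V) : Prop :=
  ∃ (n : ℕ) (e : c ≃ (Fin n → Bool)),
    ∀ a b : c, G.Adj (a : V) (b : V) ↔ ∃! i : Fin n, e a i ≠ e b i

/-- A maximal cube. -/
def IsMaxCube (G : SimpleGraph V) (c : Set V) : Prop :=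
  IsCube G c ∧ ∀ c' : Set V, IsCube G c' → c ⊆ c' → c' = c

/-- Completeness: there is no infinite ascending chain of cubes. -/
def CubeComplete (G : SimpleGraph V) : Prop :=
  ¬ ∃ c : ℕ → Set V, (∀ n : ℕ, IsCube G (c n)) ∧ ∀ n : ℕ, c n ⊂ c (n + 1)

/-- No free faces: no non-maximal cube is contained in a unique maximal cube. -/
def NoFreeFaces (G : SimpleGraph V) : Prop :=
  ∀ c : Set V, IsCube G c → ¬ IsMaxCube G c → ¬ ∃! m : Set V, IsMaxCube G m ∧ c ⊆ m

/-- #𝒲(x, z | y, w): the number of hyperplanes separating x and z from y and w,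
counted through the sides containing x and z. -/
noncomputable def sepCount (x z y w : Set (Set V)) : ℕ∞ :=
  {h : Set V | h ∈ x ∧ h ∈ z ∧ h ∉ y ∧ h ∉ w}.encard

/-- A Möbius map between Roller boundaries: it maps 𝒜(X) into 𝒜(Y) and preserves
cross ratios. -/
def Mobius (G : SimpleGraph V) (G' : SimpleGraph V') (f : Bdry G → Bdry G') : Prop :=
  ∀ x y z w : Bdry G, memA G x.1 y.1 z.1 w.1 →
    memA G' (f x).1 (f y).1 (f z).1 (f w).1 ∧
    ∀ (v : V) (v' : V'),
      crv G' v' (f x).1 (f y).1 (f z).1 (f w).1 = crv G v x.1 y.1 z.1 w.1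

/-- The induced action of a cubical isomorphism on X̄: an ultrafilter is mapped to
the set of images of its halfspaces. -/
def mapUltra (φ : V → V') (σ : Set (Set V)) : Set (Set V') :=
  (fun h : Set V => φ '' h) '' σ

/-- The standard cubulation of ℝ: vertex set ℤ, edges between consecutive integers. -/
def zline : SimpleGraph ℤ := SimpleGraph.fromRel (fun m n => n = m + 1)

end CCCR

open CCCR
namespace CCCR

section aux
variable {V : Type*} {G : SimpleGraph V}

lemma exists_closer (hG : IsCCC G) {p q : V} (h : p ≠ q) :
    ∃ p', G.Adj p p' ∧ G.dist p' q + 1 = G.dist p q := by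
  obtain ⟨w, hw⟩ := hG.1.exists_walk_length_eq_dist p q
  cases w with
  | nil => exact absurd rfl h
  | @cons _ p' _ e w =>
    refine ⟨p', e, ?_⟩
    have h1 : G.dist p' q ≤ w.length := SimpleGraph.dist_le w
    have h2 := hG.1.dist_triangle (u := p) (v := p') (w := q)
    have h3 : G.dist p p' = 1 := SimpleGraph.dist_eq_one_iff_adj.2 e
    simp only [SimpleGraph.Walk.length_cons] at hw
    omega

lemma eq_of_d0 (hG : IsCCC G) {p q : V} (h : G.dist p q = 0) : p = q :=
  hG.1.dist_eq_zero_iff.1 h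

lemma adj_d {p q : V} : G.Adj p q ↔ G.dist p q = 1 := SimpleGraph.dist_eq_one_iff_adj.symm

lemma dist_ne (hG : IsCCC G) {u v : V} (w : V) (h : G.Adj u v) : G.dist w u ≠ G.dist w v := by
  intro he
  obtain ⟨m, ⟨h1, h2, h3⟩, -⟩ := hG.2 u v w
  simp only [vInterval, mem_setOf_eq] at h1 h2 h3
  have := adj_d.1 h
  rw [G.dist_comm (u := v) (v := m), G.dist_comm (u := m) (v := w)] at h2
  rw [G.dist_comm (u := m) (v := u)] at h3
  rw [G.dist_comm (u := v) (v := w)] at h2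
  omega

lemma dist_adj (hG : IsCCC G) {u v : V} (w : V) (h : G.Adj u v) :
    G.dist w u = G.dist w v + 1 ∨ G.dist w v = G.dist w u + 1 := by
  have h0 := dist_ne hG w h
  have h1 := hG.1.dist_triangle (u := w) (v := u) (w := v)
  have h2 := hG.1.dist_triangle (u := w) (v := v) (w := u)
  have h3 := adj_d.1 h
  rw [G.dist_comm (u := v) (v := u)] at h2
  omega

lemma dist_two (hG : IsCCC G) {a b v : V} (ha : G.Adj v a) (hb : G.Adj v b) (hab : a ≠ b) :
    G.dist a b = 2 := by
  have h1 := dist_adj hG a hb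
  have h2 := adj_d.1 ha.symm
  have h3 : G.dist a b ≠ 0 := fun h => hab (eq_of_d0 hG h)
  omega

lemma mem_half {u v w : V} : w ∈ edgeHalf G u v ↔ G.dist w v < G.dist w u := Iff.rfl

lemma compl_half (hG : IsCCC G) {u v : V} (h : G.Adj u v) :
    (edgeHalf G u v)ᶜ = edgeHalf G v u := by
  ext w
  have := dist_ne hG w h
  simp only [mem_compl_iff, mem_half]
  omega

lemma half_is {u v : V} (h : G.Adj u v) : IsHalfspace G (edgeHalf G u v) := ⟨u, v, h, rfl⟩

lemma compl_is (hG : IsCCC G) {h : Set V} (hh : IsHalfspace G h) : IsHalfspace G hᶜ := by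
  obtain ⟨u, v, e, rfl⟩ := hh
  have := compl_half hG e
  exact ⟨v, u, e.symm, this⟩

lemma right_mem {u v : V} (h : G.Adj u v) : v ∈ edgeHalf G u v := by
  simp [mem_half, adj_d.1 h.symm]

lemma left_not_mem {u v : V} : u ∉ edgeHalf G u v := by
  simp [mem_half]

/-- The common neighbour towards `w` of two vertices at distance two. -/
lemma exists_down (hG : IsCCC G) {a b w : V} (hab : G.dist a b = 2)
    (h : G.dist w a = G.dist w b) :
    ∃ m, G.Adj a m ∧ G.Adj b m ∧ G.dist w m + 1 = G.dist w a := by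
  obtain ⟨m, ⟨h1, h2, h3⟩, -⟩ := hG.2 a b w
  simp only [vInterval, mem_setOf_eq] at h1 h2 h3
  rw [G.dist_comm (u := m) (v := w), G.dist_comm (u := b) (v := w)] at h2
  rw [G.dist_comm (u := m) (v := a)] at h3
  rw [G.dist_comm (u := m) (v := b)] at h1
  exact ⟨m, adj_d.2 (by omega), adj_d.2 (by omega), by omega⟩

lemma no_K23 (hG : IsCCC G) {a b x y z : V} (hab : a ≠ b) (hxy : x ≠ y) (hyz : y ≠ z)
    (hzx : z ≠ x) (ax : G.Adj a x) (ay : G.Adj a y) (az : G.Adj a z)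
    (bx : G.Adj b x) (byy : G.Adj b y) (bz : G.Adj b z) : False := by
  obtain ⟨m, -, hm⟩ := hG.2 x y z
  have key : ∀ c : V, G.Adj c x → G.Adj c y → G.Adj c z → c = m := by
    intro c cx cy cz
    apply hm
    simp only [vInterval, mem_setOf_eq]
    rw [dist_two hG cx cy hxy, dist_two hG cy cz hyz, dist_two hG cz cx hzx,
      adj_d.1 cx, adj_d.1 cy, adj_d.1 cz, adj_d.1 cx.symm, adj_d.1 cy.symm, adj_d.1 cz.symm]
    simp
  exact hab ((key a ax ay az).trans (key b bx byy bz).symm)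

lemma square_half_sub (hG : IsCCC G) {x y m z : V} (xy : G.Adj x y) (ym : G.Adj y m)
    (mz : G.Adj m z) (zx : G.Adj z x) (hxm : x ≠ m) (hyz : y ≠ z) :
    edgeHalf G x y ⊆ edgeHalf G z m := by
  intro w hw
  rw [mem_half] at hw ⊢
  by_contra hc
  have h1 := dist_adj hG w xy
  have h2 := dist_adj hG w ym
  have h3 := dist_adj hG w mz
  have h4 := dist_adj hG w zx
  have h5 : G.dist w y = G.dist w z := by omega
  obtain ⟨n, yn, zn, hn⟩ := exists_down hG (dist_two hG xy zx.symm hyz) h5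
  refine no_K23 hG (a := y) (b := z) (x := x) (y := m) (z := n) hyz hxm ?_ ?_
    xy.symm ym yn zx mz.symm zn
  · rintro rfl; omega
  · rintro rfl; omega

lemma square_half (hG : IsCCC G) {x y m z : V} (xy : G.Adj x y) (ym : G.Adj y m)
    (mz : G.Adj m z) (zx : G.Adj z x) (hxm : x ≠ m) (hyz : y ≠ z) :
    edgeHalf G x y = edgeHalf G z m :=
  Subset.antisymm (square_half_sub hG xy ym mz zx hxm hyz)
    (square_half_sub hG mz.symm ym.symm xy.symm zx.symm hyz.symm hxm.symm)

lemma half_eq_aux (hG : IsCCC G) {u v : V} (uv : G.Adj u v) :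
    ∀ n : ℕ, ∀ x y : V, G.Adj x y → G.dist x u = n → x ∉ edgeHalf G u v → y ∈ edgeHalf G u v →
      edgeHalf G x y = edgeHalf G u v := by
  intro n
  induction n with
  | zero =>
    intro x y xy h hx hy
    have hx' := eq_of_d0 hG h
    subst hx'
    rw [mem_half] at hy
    have : G.dist y x = 1 := adj_d.1 xy.symm
    have : y = v := eq_of_d0 hG (by omega)
    rw [this]
  | succ n ih =>
    intro x y xy h hx hy
    rw [mem_half] at hx hy
    have e1 := dist_adj hG x uv
    have e2 := dist_adj hG y uv
    have e3 := dist_adj hG u xy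
    have e4 := dist_adj hG v xy
    simp only [G.dist_comm (u := u), G.dist_comm (u := v)] at e3 e4
    obtain ⟨x1, xx1, hx1⟩ := exists_closer hG (p := x) (q := u)
      (by rintro rfl; simp at h)
    have e5 := dist_adj hG v xx1
    have e6 := dist_adj hG x1 uv
    simp only [G.dist_comm (u := v)] at e5
    have hyx1 : y ≠ x1 := by rintro rfl; omega
    obtain ⟨m, ym, x1m, hm⟩ := exists_down hG (w := v) (dist_two hG xy xx1 hyx1)
      (by simp only [G.dist_comm (u := v)]; omega)
    simp only [G.dist_comm (u := v)] at hm
    have e7 := dist_adj hG u ym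
    simp only [G.dist_comm (u := u)] at e7
    have e8 := dist_adj hG m uv
    have := ih x1 m x1m (by omega) (by rw [mem_half]; omega) (by rw [mem_half]; omega)
    rw [← this]
    exact square_half hG xy ym x1m.symm xx1.symm (by rintro rfl; omega) hyx1

/-- An edge crossing a halfspace is dual to it. -/
lemma half_eq (hG : IsCCC G) {h : Set V} (hh : IsHalfspace G h) {x y : V} (xy : G.Adj x y)
    (hx : x ∉ h) (hy : y ∈ h) : h = edgeHalf G x y := by
  obtain ⟨u, v, uv, rfl⟩ := hh
  exact (half_eq_aux hG uv _ x y xy rfl hx hy).symm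

lemma nonext (hG : IsCCC G) (hne : NoExtremal G) {v a : V} (va : G.Adj v a) :
    ∃ b, G.Adj v b ∧ b ≠ a ∧ edgeHalf G v a ∩ edgeHalf G v b = ∅ := by
  by_contra hc
  push Not at hc
  refine hne v ⟨a, va, fun b vb hba => ?_⟩
  obtain ⟨w, h1, h2⟩ := (hc b vb hba)
  rw [mem_half] at h1 h2
  have e1 := dist_adj hG w va
  have e2 := dist_adj hG w vb
  obtain ⟨m, am, bm, hm⟩ := exists_down hG (w := w) (dist_two hG va vb hba.symm) (by omega)
  exact ⟨m, by rintro rfl; omega, am, bm⟩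

lemma square_of_inter (hG : IsCCC G) {v a b : V} (va : G.Adj v a) (vb : G.Adj v b) (hba : b ≠ a)
    (h : (edgeHalf G v a ∩ edgeHalf G v b).Nonempty) : SpansSquare G v a b := by
  obtain ⟨w, h1, h2⟩ := h
  rw [mem_half] at h1 h2
  have e1 := dist_adj hG w va
  have e2 := dist_adj hG w vb
  obtain ⟨m, am, bm, hm⟩ := exists_down hG (w := w) (dist_two hG va vb hba.symm) (by omega)
  exact ⟨m, by rintro rfl; omega, am, bm⟩

/-- Straight rays produce boundary points. -/
lemma ray_lemma (hG : IsCCC G) (hne : NoExtremal G) {u v : V} (uv : G.Adj u v) :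
    ∃ σ, IsBdryPt G σ ∧ edgeHalf G u v ∈ σ ∧ ∀ h ∈ σ, u ∈ h ∨ h ⊆ edgeHalf G u v := by
  have step : ∀ e : {e : V × V // G.Adj e.1 e.2}, ∃ f : {e : V × V // G.Adj e.1 e.2},
      f.1.1 = e.1.2 ∧ edgeHalf G f.1.1 f.1.2 ⊆ edgeHalf G e.1.1 e.1.2 := by
    rintro ⟨⟨x, y⟩, xy⟩
    obtain ⟨b, yb, -, hb⟩ := nonext hG hne xy.symm
    refine ⟨⟨(y, b), yb⟩, rfl, ?_⟩
    intro w hw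
    by_contra hc
    have : w ∈ edgeHalf G y x := by rw [← compl_half hG xy]; exact hc
    have : w ∈ edgeHalf G y x ∩ edgeHalf G y b := ⟨this, hw⟩
    rw [hb] at this
    exact this
  choose nx nx1 nx2 using step
  let E : ℕ → {e : V × V // G.Adj e.1 e.2} := fun n => nx^[n] ⟨(u, v), uv⟩
  have Es : ∀ n, E (n + 1) = nx (E n) := fun n => Function.iterate_succ_apply' _ _ _
  let r : ℕ → V := fun n => (E n).1.1
  have r1 : ∀ n, (E n).1.2 = r (n + 1) := by
    intro n
    show _ = (E (n + 1)).1.1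
    rw [Es, nx1]
  have radj : ∀ n, G.Adj (r n) (r (n + 1)) := by
    intro n; rw [← r1]; exact (E n).2
  have rsub : ∀ n, edgeHalf G (r (n + 1)) (r (n + 1 + 1)) ⊆ edgeHalf G (r n) (r (n + 1)) := by
    intro n
    have := nx2 (E n)
    rw [← Es, r1, r1] at this
    exact this
  have rsub' : ∀ m n, m ≤ n →
      edgeHalf G (r n) (r (n + 1)) ⊆ edgeHalf G (r m) (r (m + 1)) := by
    intro m n hmn
    induction n, hmn using Nat.le_induction with
    | base => exact Subset.rfl
    | succ n _ ih => exact (rsub n).trans ih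
  have r0 : r 0 = u := rfl
  have r01 : r 1 = v := (r1 0).symm
  have hmem : ∀ m n, m < n → r n ∈ edgeHalf G (r m) (r (m + 1)) := by
    intro m n hmn
    obtain ⟨k, rfl⟩ := Nat.exists_eq_add_of_lt hmn
    exact rsub' m (m + k) (by omega) (right_mem (radj _))
  have enter : ∀ h, IsHalfspace G h → ∀ m n, m ≤ n → r m ∉ h → r n ∈ h →
      ∃ i, h = edgeHalf G (r i) (r (i + 1)) := by
    intro h hh m n hmn
    induction n, hmn using Nat.le_induction with
    | base => intro a b; exact absurd b a
    | succ n _ ih =>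
      intro a b
      by_cases c : r n ∈ h
      · exact ih a c
      · exact ⟨n, half_eq hG hh (radj n) c b⟩
  have ev : ∀ h, IsHalfspace G h → (∃ N, ∀ n, N ≤ n → r n ∈ h) ∨ ∃ N, ∀ n, N ≤ n → r n ∉ h := by
    intro h hh
    by_cases c : ∃ N, ∀ n, N ≤ n → r n ∉ h
    · exact Or.inr c
    by_cases c' : ∀ n, r n ∈ h
    · exact Or.inl ⟨0, fun n _ => c' n⟩
    push Not at c c'
    obtain ⟨m, hm⟩ := c'
    obtain ⟨n, hmn, hn⟩ := c m
    obtain ⟨i, rfl⟩ := enter h hh m n hmn hm hn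
    exact Or.inl ⟨i + 1, fun n hn => hmem i n (by omega)⟩
  refine ⟨rayEnd G r, ⟨⟨fun h hh => hh.1, fun h hh => ⟨?_, ?_⟩, ?_⟩, ?_⟩, ?_, ?_⟩
  · rintro ⟨-, N, hN⟩ ⟨-, M, hM⟩
    exact hM (max N M) (le_max_right _ _) (hN _ (le_max_left _ _))
  · intro hc
    rcases ev h hh with h1 | ⟨N, hN⟩
    · exact ⟨hh, h1⟩
    · exact absurd ⟨compl_is hG hh, N, hN⟩ hc
  · rintro h ⟨-, N, hN⟩ k ⟨-, M, hM⟩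
    exact ⟨_, hN (max N M) (le_max_left _ _), hM (max N M) (le_max_right _ _)⟩
  · intro p hp
    have hin : ∀ n, p ∈ edgeHalf G (r n) (r (n + 1)) := by
      intro n
      have : edgeHalf G (r n) (r (n + 1)) ∈ rayEnd G r :=
        ⟨half_is (radj n), n + 1, fun k hk => hmem n k (by omega)⟩
      rw [hp] at this
      exact this.2
    have : ∀ n, G.dist p (r n) + n ≤ G.dist p (r 0) := by
      intro n
      induction n with
      | zero => simp
      | succ n ih =>
        have := hin n
        rw [mem_half] at this
        omega
    have := this (G.dist p (r 0) + 1)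
    omega
  · refine ⟨half_is uv, 1, fun k hk => ?_⟩
    have := hmem 0 k (by omega)
    rwa [r0, r01] at this
  · rintro h ⟨hh, N, hN⟩
    by_cases c : u ∈ h
    · exact Or.inl c
    · right
      obtain ⟨i, rfl⟩ := enter h hh 0 N (by omega) c (hN N le_rfl)
      have := rsub' 0 i (by omega)
      rwa [r0, r01] at this

/-- A chain of halfspaces not separated by the boundary. -/
structure Chain (G : SimpleGraph V) (H : ℤ → Set V) : Prop where
  is : ∀ n, IsHalfspace G (H n)
  lt : ∀ n, H n ⊂ H (n + 1)
  bd : ∀ σ, IsBdryPt G σ → ∀ m n, H m ∈ σ → H n ∈ σ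

lemma Chain.rev (hG : IsCCC G) {H : ℤ → Set V} (c : Chain G H) :
    Chain G (fun n => (H (-n))ᶜ) where
  is n := compl_is hG (c.is _)
  lt n := by
    have := c.lt (-(n + 1))
    rw [show -(n + 1) + 1 = -n by ring] at this
    exact compl_lt_compl_iff_lt.2 this
  bd σ hσ m n h := by
    by_contra hc
    have h1 := (hσ.1.2.1 _ (c.is (-n))).2 hc
    exact (hσ.1.2.1 _ (c.is (-m))).1 (c.bd σ hσ (-n) (-m) h1) h

lemma Chain.mono {H : ℤ → Set V} (c : Chain G H) {m n : ℤ} (h : m ≤ n) : H m ⊆ H n := by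
  induction n, h using Int.le_induction with
  | base => exact Subset.rfl
  | succ n _ ih => exact ih.trans (c.lt n).1

lemma Chain.nonempty {H : ℤ → Set V} (c : Chain G H) (n : ℤ) : (H n).Nonempty := by
  obtain ⟨u, v, uv, h⟩ := c.is n
  rw [h]
  exact ⟨v, right_mem uv⟩

lemma Chain.exh (hG : IsCCC G) {H : ℤ → Set V} (c : Chain G H) (p : V) : ∃ n, p ∈ H n := by
  obtain ⟨q, hq⟩ := c.nonempty 0
  obtain ⟨w⟩ := hG.1.preconnected q p
  have : ∀ {x y : V} (_ : G.Walk x y), (∃ n, x ∈ H n) → ∃ n, y ∈ H n := by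
    intro x y w
    induction w with
    | nil => exact id
    | @cons x z y e w ih =>
      rintro ⟨n, hn⟩
      apply ih
      refine ⟨n + 1, ?_⟩
      by_contra hz
      have h1 := half_eq hG (c.is (n + 1)) e.symm hz ((c.lt n).1 hn)
      have h2 := half_eq hG (c.is n) e.symm (fun h => hz ((c.lt n).1 h)) hn
      exact (c.lt n).ne (h2.trans h1.symm)
  exact this w ⟨0, hq⟩

lemma Chain.exh' (hG : IsCCC G) {H : ℤ → Set V} (c : Chain G H) (p : V) : ∃ n, p ∉ H n := by
  obtain ⟨n, hn⟩ := (c.rev hG).exh hG p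
  exact ⟨_, hn⟩

/-- The oriented edge points to the positive end. -/
def PosE (G : SimpleGraph V) (H : ℤ → Set V) (u v : V) : Prop :=
  ∀ m, u ∉ H m → H m ⊆ edgeHalf G u v

def NegE (G : SimpleGraph V) (H : ℤ → Set V) (u v : V) : Prop :=
  ∀ m, u ∈ H m → (H m)ᶜ ⊆ edgeHalf G u v

lemma neg_iff_rev {H : ℤ → Set V} {u v : V} :
    NegE G H u v ↔ PosE G (fun n => (H (-n))ᶜ) u v := by
  constructor
  · intro h m hm
    exact h (-m) (not_not.1 hm)
  · intro h m hm
    have := h (-m)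
    simp only [neg_neg] at this
    exact this (not_not.2 hm)

lemma Chain.dich (hG : IsCCC G) (hne : NoExtremal G) {H : ℤ → Set V} (c : Chain G H) {u v : V}
    (uv : G.Adj u v) : PosE G H u v ∨ NegE G H u v := by
  obtain ⟨σ, hσ, h1, h2⟩ := ray_lemma hG hne uv
  by_cases h : H 0 ∈ σ
  · left
    intro m hm
    exact (h2 _ (c.bd σ hσ 0 m h)).resolve_left hm
  · right
    intro m hm
    have : (H m)ᶜ ∈ σ := by
      by_contra hc
      exact h (c.bd σ hσ m 0 ((hσ.1.2.1 _ (c.is m)).2 hc))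
    exact (h2 _ this).resolve_left (not_not.2 hm)

lemma Chain.pos_inter (hG : IsCCC G) {H : ℤ → Set V} (c : Chain G H) {u v x y : V}
    (h1 : PosE G H u v) (h2 : PosE G H x y) : (edgeHalf G u v ∩ edgeHalf G x y).Nonempty := by
  obtain ⟨m, hm⟩ := c.exh' hG u
  obtain ⟨n, hn⟩ := c.exh' hG x
  obtain ⟨z, hz⟩ := c.nonempty (min m n)
  exact ⟨z, h1 m hm (c.mono (min_le_left _ _) hz), h2 n hn (c.mono (min_le_right _ _) hz)⟩

lemma Chain.neg_inter (hG : IsCCC G) {H : ℤ → Set V} (c : Chain G H) {u v x y : V}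
    (h1 : NegE G H u v) (h2 : NegE G H x y) : (edgeHalf G u v ∩ edgeHalf G x y).Nonempty :=
  (c.rev hG).pos_inter hG (neg_iff_rev.1 h1) (neg_iff_rev.1 h2)

lemma half_disj {u v : V} : ¬ (edgeHalf G u v ∩ edgeHalf G v u).Nonempty := by
  rintro ⟨w, h1, h2⟩
  rw [mem_half] at h1 h2
  omega

lemma Chain.pos_rev (hG : IsCCC G) (hne : NoExtremal G) {H : ℤ → Set V} (c : Chain G H) {u v : V}
    (uv : G.Adj u v) (h : PosE G H u v) : NegE G H v u :=
  (c.dich hG hne uv.symm).resolve_left fun h' => half_disj (c.pos_inter hG h h')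

lemma Chain.neg_rev (hG : IsCCC G) (hne : NoExtremal G) {H : ℤ → Set V} (c : Chain G H) {u v : V}
    (uv : G.Adj u v) (h : NegE G H u v) : PosE G H v u :=
  (c.dich hG hne uv.symm).resolve_right fun h' => half_disj (c.neg_inter hG h h')

lemma Chain.not_both (hG : IsCCC G) (hne : NoExtremal G) {H : ℤ → Set V} (c : Chain G H) {u v : V}
    (uv : G.Adj u v) (h : PosE G H u v) (h' : NegE G H u v) : False :=
  half_disj (c.neg_inter hG h' (c.pos_rev hG hne uv h))

lemma Chain.pos_unique (hG : IsCCC G) (hne : NoExtremal G) {H : ℤ → Set V} (c : Chain G H) :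
    ∀ {p q r : V}, G.Adj p q → G.Adj p r → PosE G H p q → PosE G H p r → q = r := by
  intro p
  obtain ⟨m, hm⟩ := c.exh' hG p
  obtain ⟨z, hz⟩ := c.nonempty m
  have key : ∀ N : ℕ, ∀ p q r : V, G.dist z p < N → p ∉ H m → G.Adj p q → G.Adj p r →
      PosE G H p q → PosE G H p r → q = r := by
    intro N
    induction N with
    | zero => intro p q r h; omega
    | succ N ih =>
      intro p q r hN hp pq pr hq hr
      by_contra hqr
      by_cases hrm : r ∈ H m
      · have := hq m hp hrm
        rw [mem_half, adj_d.1 pr.symm] at this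
        exact hqr (eq_of_d0 hG (by omega)).symm
      have hzr := hr m hp hz
      rw [mem_half] at hzr
      obtain ⟨w, hwp, rw', qw⟩ := square_of_inter hG pr pq hqr (c.pos_inter hG hr hq)
      have e1 : edgeHalf G p q = edgeHalf G r w :=
        square_half hG pq qw rw'.symm pr.symm hwp.symm hqr
      have hw : PosE G H r w := by
        refine (c.dich hG hne rw').resolve_right fun h => ?_
        have h2 := c.neg_inter hG h (c.pos_rev hG hne pq hq)
        rw [← e1] at h2
        exact half_disj h2
      obtain ⟨b, rb, hbp, hb⟩ := nonext hG hne pr.symm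
      have hbpos : PosE G H r b := by
        refine (c.dich hG hne rb).resolve_right fun h => ?_
        exact (c.neg_inter hG (c.pos_rev hG hne pr hr) h).ne_empty hb
      have hbw : b = w := ih r b w (by omega) hrm rb rw' hbpos hw
      subst hbw
      have : q ∈ edgeHalf G r p ∩ edgeHalf G r b := by
        refine ⟨?_, e1 ▸ right_mem pq⟩
        rw [mem_half, adj_d.1 pq.symm, dist_two hG pq pr hqr]
        omega
      rw [hb] at this
      exact this
  intro q r
  exact key _ p q r (Nat.lt_succ_self _) hm

lemma Chain.neg_unique (hG : IsCCC G) (hne : NoExtremal G) {H : ℤ → Set V} (c : Chain G H)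
    {p q r : V} (pq : G.Adj p q) (pr : G.Adj p r) (hq : NegE G H p q) (hr : NegE G H p r) :
    q = r :=
  (c.rev hG).pos_unique hG hne pq pr (neg_iff_rev.1 hq) (neg_iff_rev.1 hr)

lemma Chain.is_line (hG : IsCCC G) (hnt : Nontrivial V) (hne : NoExtremal G) {H : ℤ → Set V}
    (c : Chain G H) : Nonempty (G ≃g zline) := by
  have pn : ∀ {v a b : V}, PosE G H v a → G.Adj v b → edgeHalf G v a ∩ edgeHalf G v b = ∅ →
      NegE G H v b := fun h vb hd =>
    (c.dich hG hne vb).resolve_left fun h' => (c.pos_inter hG h h').ne_empty hd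
  have np : ∀ {v a b : V}, NegE G H v a → G.Adj v b → edgeHalf G v a ∩ edgeHalf G v b = ∅ →
      PosE G H v b := fun h vb hd =>
    (c.dich hG hne vb).resolve_right fun h' => (c.neg_inter hG h h').ne_empty hd
  have ex : ∀ v, ∃ a b, G.Adj v a ∧ G.Adj v b ∧ PosE G H v a ∧ NegE G H v b := by
    intro v
    obtain ⟨w, hw⟩ := exists_ne v
    obtain ⟨a, va, -⟩ := exists_closer hG hw.symm
    obtain ⟨b, vb, -, hd⟩ := nonext hG hne va
    rcases c.dich hG hne va with h | h
    · exact ⟨a, b, va, vb, h, pn h vb hd⟩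
    · exact ⟨b, a, vb, va, np h vb hd, h⟩
  choose s t hs ht ps nt using ex
  have ts : ∀ v, t (s v) = v := fun v =>
    c.neg_unique hG hne (ht _) (hs v).symm (nt _) (c.pos_rev hG hne (hs v) (ps v))
  have st : ∀ v, s (t v) = v := fun v =>
    c.pos_unique hG hne (hs _) (ht v).symm (ps _) (c.neg_rev hG hne (ht v) (nt v))
  let S : Equiv.Perm V := ⟨s, t, ts, st⟩
  have hS : ∀ v, S v = s v := fun _ => rfl
  have hS' : ∀ v, S⁻¹ v = t v := fun _ => rfl
  have adj : ∀ v w, G.Adj v w ↔ w = s v ∨ w = t v := by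
    intro v w
    constructor
    · intro h
      rcases c.dich hG hne h with h' | h'
      · exact Or.inl (c.pos_unique hG hne h (hs v) h' (ps v))
      · exact Or.inr (c.neg_unique hG hne h (ht v) h' (nt v))
    · rintro (rfl | rfl)
      · exact hs v
      · exact ht v
  have nest : ∀ v, edgeHalf G (s v) (s (s v)) ⊆ edgeHalf G v (s v) := by
    intro v
    obtain ⟨b, hb, -, hd⟩ := nonext hG hne (hs v).symm
    have hb' := np (c.pos_rev hG hne (hs v) (ps v)) hb hd
    have : b = s (s v) := c.pos_unique hG hne hb (hs _) hb' (ps _)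
    subst this
    intro w hw
    by_contra hc
    have : w ∈ edgeHalf G (s v) v := by rw [← compl_half hG (hs v)]; exact hc
    have : w ∈ edgeHalf G (s v) v ∩ edgeHalf G (s v) (s (s v)) := ⟨this, hw⟩
    rw [hd] at this
    exact this
  have nest' : ∀ n : ℕ, ∀ v, edgeHalf G ((S ^ n) v) (s ((S ^ n) v)) ⊆ edgeHalf G v (s v) := by
    intro n v
    induction n with
    | zero => simp
    | succ n ih =>
      rw [pow_succ', Equiv.Perm.mul_apply, hS]
      exact (nest _).trans ih
  have nofix : ∀ n : ℕ, ∀ v, (S ^ (n + 1)) v ≠ v := by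
    intro n v h
    have h1 := nest' n v (right_mem (hs _))
    have h2 : s ((S ^ n) v) = v := by
      rw [pow_succ', Equiv.Perm.mul_apply] at h
      exact h
    rw [h2] at h1
    exact left_not_mem h1
  obtain ⟨v0⟩ : Nonempty V := inferInstance
  let L : ℤ → V := fun n => (S ^ n) v0
  have Ls : ∀ n, L (n + 1) = s (L n) := by
    intro n
    show (S ^ (n + 1)) v0 = S ((S ^ n) v0)
    rw [add_comm, zpow_add, zpow_one, Equiv.Perm.mul_apply]
  have Lt : ∀ n, L (n - 1) = t (L n) := by
    intro n
    have := Ls (n - 1)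
    rw [sub_add_cancel] at this
    rw [this, ts]
  have Lpow : ∀ (k : ℕ) n, L (n + k) = (S ^ k) (L n) := by
    intro k n
    show (S ^ (n + k)) v0 = (S ^ k) ((S ^ n) v0)
    rw [add_comm, zpow_add, zpow_natCast, Equiv.Perm.mul_apply]
  have Llt : ∀ m n, m < n → L m ≠ L n := by
    intro m n hmn h
    obtain ⟨k, hk⟩ := Int.eq_ofNat_of_zero_le (show 0 ≤ n - m - 1 by omega)
    have : n = m + ((k + 1 : ℕ) : ℤ) := by push_cast; omega
    rw [this, Lpow] at h
    exact nofix k _ h.symm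
  have Linj : Function.Injective L := by
    intro m n h
    rcases lt_trichotomy m n with h1 | h1 | h1
    · exact absurd h (Llt _ _ h1)
    · exact h1
    · exact absurd h.symm (Llt _ _ h1)
  have Lsurj : Function.Surjective L := by
    intro p
    obtain ⟨w⟩ := hG.1.preconnected v0 p
    have : ∀ {x y : V} (_ : G.Walk x y), (∃ n, L n = x) → ∃ n, L n = y := by
      intro x y w
      induction w with
      | nil => exact id
      | @cons x z y e w ih =>
        rintro ⟨n, rfl⟩
        apply ih
        rcases (adj _ _).1 e with h | h
        · exact ⟨n + 1, by rw [Ls, h]⟩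
        · exact ⟨n - 1, by rw [Lt, h]⟩
    exact this w ⟨0, by simp [L]⟩
  refine ⟨(RelIso.symm ⟨Equiv.ofBijective L ⟨Linj, Lsurj⟩, ?_⟩)⟩
  intro m n
  show G.Adj (L m) (L n) ↔ zline.Adj m n
  rw [adj, ← Ls, ← Lt, Linj.eq_iff, Linj.eq_iff]
  simp only [zline, SimpleGraph.fromRel_adj]
  omega

lemma image_half (φ : G ≃g G) (hG : IsCCC G) {h : Set V} (hh : IsHalfspace G h) :
    IsHalfspace G (φ '' h) := by
  have hle : ∀ (ψ : G ≃g G) (x y : V), G.dist (ψ x) (ψ y) ≤ G.dist x y := by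
    intro ψ x y
    obtain ⟨w, hw⟩ := hG.1.exists_walk_length_eq_dist x y
    rw [← hw, ← SimpleGraph.Walk.length_map ψ.toHom w]
    exact SimpleGraph.dist_le _
  have hd : ∀ x y : V, G.dist (φ x) (φ y) = G.dist x y := by
    intro x y
    refine le_antisymm (hle φ x y) ?_
    have := hle φ.symm (φ x) (φ y)
    simpa using this
  obtain ⟨u, v, uv, rfl⟩ := hh
  refine ⟨φ u, φ v, φ.map_adj_iff.2 uv, ?_⟩
  ext w
  obtain ⟨x, rfl⟩ := φ.surjective w
  simp only [mem_image, mem_setOf_eq, hd]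
  constructor
  · rintro ⟨y, hy, e⟩
    rw [φ.injective e] at hy
    exact hy
  · intro hx
    exact ⟨x, hx, rfl⟩

lemma chain_of_iso (hG : IsCCC G) (φ : G ≃g G)
    (hφ : ∀ σ, IsBdryPt G σ → ∀ h, h ∈ σ ↔ φ '' h ∈ σ) {h : Set V} (hh : IsHalfspace G h)
    (hlt : h ⊂ φ '' h) : ∃ H, Chain G H := by
  have hs : ∀ n : ℤ, (⇑(φ ^ (n + 1)) '' h) = φ '' ((φ ^ n) '' h) := by
    intro n
    rw [add_comm, zpow_add, zpow_one, ← image_comp]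
    rfl
  have hs' : ∀ n : ℤ, (⇑(φ ^ (n + 1)) '' h) = (φ ^ n) '' (φ '' h) := by
    intro n
    rw [zpow_add, zpow_one, ← image_comp]
    rfl
  refine ⟨fun n => (φ ^ n) '' h, fun n => image_half _ hG hh, fun n => ?_, fun σ hσ => ?_⟩
  · show (φ ^ n) '' h ⊂ (φ ^ (n + 1)) '' h
    rw [hs']
    exact (Function.Injective.image_strictMono (φ ^ n).injective) hlt
  · have h0 : ∀ n : ℤ, (φ ^ n) '' h ∈ σ ↔ (φ ^ (0 : ℤ)) '' h ∈ σ := by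
      intro n
      induction n using Int.induction_on with
      | zero => rfl
      | succ n ih => rw [hs, ← hφ σ hσ, ih]
      | pred n ih =>
        rw [← ih, hφ σ hσ, ← hs, sub_add_cancel]
    intro m n hm
    exact (h0 n).2 ((h0 m).1 hm)

lemma half_walk_to (hG : IsCCC G) {u v : V} : ∀ n : ℕ, ∀ p : V, G.dist p v = n →
    p ∈ edgeHalf G u v → ∀ k : Set V, (p ∈ k ↔ v ∉ k) →
    ∃ x y, G.Adj x y ∧ x ∈ edgeHalf G u v ∧ y ∈ edgeHalf G u v ∧ x ∉ k ∧ y ∈ k := by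
  intro n
  induction n with
  | zero =>
    intro p hp _ k hk
    rw [eq_of_d0 hG hp] at hk
    tauto
  | succ n ih =>
    intro p hp hpm k hk
    obtain ⟨p', pp', hp'⟩ := exists_closer hG (p := p) (q := v)
      (by rintro rfl; simp at hp)
    have hpm' : p' ∈ edgeHalf G u v := by
      rw [mem_half] at hpm ⊢
      have := dist_adj hG u pp'
      simp only [G.dist_comm (u := u)] at this
      omega
    by_cases h1 : p ∈ k <;> by_cases h2 : p' ∈ k
    · exact ih p' (by omega) hpm' k (by tauto)
    · exact ⟨p', p, pp'.symm, hpm', hpm, h2, h1⟩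
    · exact ⟨p, p', pp', hpm, hpm', h1, h2⟩
    · exact ih p' (by omega) hpm' k (by tauto)

lemma nested (hG : IsCCC G) (hne : NoExtremal G) {h k : Set V} (hh : IsHalfspace G h)
    (hk : IsHalfspace G k) (hb : ∀ σ, IsBdryPt G σ → (h ∈ σ ↔ k ∈ σ)) : h ⊆ k ∨ k ⊆ h := by
  by_contra hc
  rw [not_or, not_subset, not_subset] at hc
  obtain ⟨⟨p, hph, hpk⟩, ⟨q, hqk, hqh⟩⟩ := hc
  have hhk : (h ∩ k).Nonempty := by
    obtain ⟨u, v, uv, rfl⟩ := hh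
    obtain ⟨σ, hσ, h1, -⟩ := ray_lemma hG hne uv
    exact hσ.1.2.2 _ h1 _ ((hb σ hσ).1 h1)
  obtain ⟨o, hoh, hok⟩ := hhk
  have : ∃ x y, G.Adj x y ∧ x ∈ h ∧ y ∈ h ∧ x ∉ k ∧ y ∈ k := by
    obtain ⟨u, v, uv, rfl⟩ := hh
    by_cases hv : v ∈ k
    · exact half_walk_to hG _ p rfl hph k (by tauto)
    · exact half_walk_to hG _ o rfl hoh k (by tauto)
  obtain ⟨x, y, xy, hx, hy, hxk, hyk⟩ := this
  have ek := half_eq hG hk xy hxk hyk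
  obtain ⟨z, xz, -, hd⟩ := nonext hG hne xy
  rw [← ek] at hd
  obtain ⟨σ, hσ, h1, h2⟩ := ray_lemma hG hne xz
  have hkσ : k ∉ σ := fun h' => (hσ.1.2.2 _ h' _ h1).ne_empty hd
  have hhσ : hᶜ ∈ σ := by
    by_contra h'
    exact hkσ ((hb σ hσ).1 ((hσ.1.2.1 _ hh).2 h'))
  rcases h2 _ hhσ with h3 | h3
  · exact h3 hx
  · have : q ∈ k ∩ edgeHalf G x z := ⟨hqk, h3 hqh⟩
    rw [hd] at this
    exact this

lemma iso_trivial (hG : IsCCC G) (hnt : Nontrivial V) (hne : NoExtremal G)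
    (hnl : ¬ Nonempty (G ≃g zline)) (φ : G ≃g G)
    (hφ : ∀ σ, IsBdryPt G σ → ∀ h, h ∈ σ ↔ φ '' h ∈ σ) (p : V) : φ p = p := by
  by_contra hp
  have hfix : ∀ h, IsHalfspace G h → φ '' h = h := by
    intro h hh
    by_contra hc
    rcases nested hG hne hh (image_half φ hG hh) (fun σ hσ => hφ σ hσ h) with h1 | h1
    · obtain ⟨H, c⟩ := chain_of_iso hG φ hφ hh (h1.ssubset_of_ne (Ne.symm hc))
      exact hnl (c.is_line hG hnt hne)
    · have hφ' : ∀ σ, IsBdryPt G σ → ∀ h, h ∈ σ ↔ φ.symm '' h ∈ σ := by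
        intro σ hσ h
        rw [hφ σ hσ (φ.symm '' h), ← image_comp]
        simp
      have : h ⊂ φ.symm '' h := by
        have h2 := (Function.Injective.image_strictMono φ.symm.injective) (h1.ssubset_of_ne hc)
        rw [← image_comp] at h2
        simpa using h2
      obtain ⟨H, c⟩ := chain_of_iso hG φ.symm hφ' hh this
      exact hnl (c.is_line hG hnt hne)
  obtain ⟨q, e, hq⟩ := exists_closer hG (p := φ p) (q := p) hp
  have h1 : p ∈ edgeHalf G (φ p) q := by
    rw [mem_half, G.dist_comm, G.dist_comm (u := p)]
    omega
  have h2 : φ p ∈ φ '' edgeHalf G (φ p) q := mem_image_of_mem _ h1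
  rw [hfix _ (half_is e)] at h2
  exact left_not_mem h2

end aux

end CCCR

/-- uniqueness in Theorem `main thm`: two cubical isomorphisms
`F, G : X → Y` whose induced maps on Roller compactifications agree on the Roller
boundary are equal. -/
theorem stmt19 {V V' : Type*} (G : SimpleGraph V) (G' : SimpleGraph V')
    (hG : IsCCC G) (hG' : IsCCC G')
    (hnt : Nontrivial V) (hnt' : Nontrivial V')
    (hne : NoExtremal G) (hne' : NoExtremal G')
    (hnl : ¬ Nonempty (G ≃g zline)) (hnl' : ¬ Nonempty (G' ≃g zline))
    (F1 F2 : G ≃g G')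
    (hagree : ∀ x : Set (Set V), IsBdryPt G x → mapUltra ⇑F1 x = mapUltra ⇑F2 x) :
    F1 = F2 := by
  have key : ∀ p, F2.symm (F1 p) = p := by
    refine iso_trivial hG hnt hne hnl (F1.trans F2.symm) ?_
    intro σ hσ h
    have e := hagree σ hσ
    have hc : F2 '' ((F1.trans F2.symm) '' h) = F1 '' h := by
      rw [← image_comp]
      apply image_congr
      intro a _
      simp
    constructor
    · intro hh
      have : F1 '' h ∈ mapUltra F1 σ := ⟨h, hh, rfl⟩
      rw [e] at this
      obtain ⟨h', hh', e'⟩ := this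
      have e'' : F2 '' h' = F1 '' h := e'
      rw [← hc] at e''
      rwa [← F2.injective.image_injective e'']
    · intro hh
      have : F1 '' h ∈ mapUltra F2 σ := ⟨_, hh, hc⟩
      rw [← e] at this
      obtain ⟨h', hh', e'⟩ := this
      rwa [← F1.injective.image_injective e']
  ext p
  have := congrArg F2 (key p)
  simpa using this
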